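/- Let E be a Hilbert space and Y = (Y_1,…,Y_{n−1}) a tuple of positive semidefinite bounded operators on E satisfying Σ_{j=1}^{n−1} Y_j ⪯ I. Then for each positive integer d and each unit vector e ∈ E there exist ℓ ∈ ℕ, a tuple E ∈ D_n(ℂ^ℓ), and a unit vector ξ ∈ ℂ^ℓ such that ‖p(Y)e‖ = ‖p(E)ξ‖ for all p ∈ ℂ⟨y⟩ of degree at most d. In particular, ‖p(Y)‖ ≤ ‖p‖ for all p ∈ ℂ⟨y⟩, where ‖p‖ is the povm(n) norm. -/

import Mathlib

open scoped ComplexOrder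

set_option synthInstance.maxHeartbeats 1000000
set_option maxHeartbeats 1000000
set_option linter.unusedSectionVars false

noncomputable section

namespace POVMStmt

/-- The tuple `Y` is a POVM tuple: each `Y_j ⪰ 0` and `Σ_j Y_j ⪯ 1`
(i.e. `Y ∈ D_n(E)` for `n - 1` generators). -/
def IsPovmTuple {k : ℕ} {E : Type*} [NormedAddCommGroup E] [InnerProductSpace ℂ E]
    [CompleteSpace E] (Y : Fin k → (E →L[ℂ] E)) : Prop :=
  (∀ j, (Y j).IsPositive) ∧ (1 - ∑ j, Y j).IsPositive

/-- `‖p‖ ≤ c` for the `povm(n)` norm: the sup of `‖p(E)‖` over all matrix levels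
`E ∈ D_n(ℂ^ℓ)`. -/
def povmNormLE (k : ℕ) (p : FreeAlgebra ℂ (Fin k)) (c : ℝ) : Prop :=
  ∀ (ℓ : ℕ) (Y : Fin k → (EuclideanSpace ℂ (Fin ℓ) →L[ℂ] EuclideanSpace ℂ (Fin ℓ))),
    IsPovmTuple Y → ‖FreeAlgebra.lift ℂ Y p‖ ≤ c

end POVMStmt

namespace POVMStmt

/-- The elements of degree at most `d` of the free algebra. -/
def degreeLE (k d : ℕ) : Submodule ℂ (FreeAlgebra ℂ (Fin k)) :=
  Submodule.span ℂ {x | ∃ l : List (Fin k), l.length ≤ d ∧ x = (l.map (FreeAlgebra.ι ℂ)).prod}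

theorem degreeLE_mono (k : ℕ) : Monotone (degreeLE k) := by
  intro d d' h
  apply Submodule.span_mono
  rintro x ⟨l, hl, rfl⟩
  exact ⟨l, hl.trans h, rfl⟩

theorem exists_mem_degreeLE {k : ℕ} (p : FreeAlgebra ℂ (Fin k)) : ∃ d, p ∈ degreeLE k d := by
  have hp : p ∈ Submodule.span ℂ
      (Submonoid.closure (Set.range (FreeAlgebra.ι ℂ : Fin k → FreeAlgebra ℂ (Fin k))) : Set _) := by
    rw [← Algebra.adjoin_eq_span, FreeAlgebra.adjoin_range_ι]
    exact Submodule.mem_top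
  induction hp using Submodule.span_induction with
  | mem x hx =>
    obtain ⟨l, hl, rfl⟩ := Submonoid.exists_list_of_mem_closure hx
    obtain ⟨m, rfl⟩ : l ∈ Set.range (List.map (FreeAlgebra.ι ℂ)) := by
      rw [Set.range_list_map]
      exact hl
    exact ⟨m.length, Submodule.subset_span ⟨m, le_rfl, rfl⟩⟩
  | zero => exact ⟨0, zero_mem _⟩
  | add x y _ _ hx hy =>
    obtain ⟨a, ha⟩ := hx
    obtain ⟨b, hb⟩ := hy
    exact ⟨max a b, add_mem (degreeLE_mono k (le_max_left a b) ha)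
      (degreeLE_mono k (le_max_right a b) hb)⟩
  | smul c x _ hx =>
    obtain ⟨a, ha⟩ := hx
    exact ⟨a, Submodule.smul_mem _ c ha⟩

section Compression

variable {k : ℕ} {E F : Type*} [NormedAddCommGroup E] [InnerProductSpace ℂ E] [CompleteSpace E]
  [NormedAddCommGroup F] [InnerProductSpace ℂ F] [CompleteSpace F]

theorem adjoint_comp_self_of_isometry (V : F →ₗᵢ[ℂ] E) (x : F) :
    ContinuousLinearMap.adjoint V.toContinuousLinearMap (V x) = x := by
  refine ext_inner_left ℂ fun y => ?_
  rw [ContinuousLinearMap.adjoint_inner_right]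
  exact V.inner_map_map y x

/-- The compression of the tuple `Y` along the isometry `V`. -/
def compress (V : F →ₗᵢ[ℂ] E) (Y : Fin k → (E →L[ℂ] E)) (j : Fin k) : F →L[ℂ] F :=
  ContinuousLinearMap.adjoint V.toContinuousLinearMap ∘L Y j ∘L V.toContinuousLinearMap

theorem IsPovmTuple.compress (V : F →ₗᵢ[ℂ] E) {Y : Fin k → (E →L[ℂ] E)} (hY : IsPovmTuple Y) :
    IsPovmTuple (compress V Y) := by
  refine ⟨fun j => (hY.1 j).adjoint_conj V.toContinuousLinearMap, ?_⟩
  convert hY.2.adjoint_conj V.toContinuousLinearMap using 1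
  ext x
  simp [POVMStmt.compress, adjoint_comp_self_of_isometry]

theorem map_word_compress (V : F →ₗᵢ[ℂ] E) (Y : Fin k → (E →L[ℂ] E)) (ξ : F) {d : ℕ}
    (hV : ∀ l : List (Fin k), l.length ≤ d → (l.map Y).prod (V ξ) ∈ Set.range V)
    (l : List (Fin k)) (hl : l.length ≤ d) :
    V ((l.map (compress V Y)).prod ξ) = (l.map Y).prod (V ξ) := by
  induction l with
  | nil => simp
  | cons a l ih =>
    have ih := ih ((Nat.le_succ _).trans hl)
    obtain ⟨x, hx⟩ := hV (a :: l) hl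
    simp only [List.map_cons, List.prod_cons, mul_apply_eq_comp] at hx ⊢
    rw [← hx]
    congr 1
    rw [← adjoint_comp_self_of_isometry V x, hx, ← ih]
    rfl

theorem map_lift_compress (V : F →ₗᵢ[ℂ] E) (Y : Fin k → (E →L[ℂ] E)) (ξ : F) {d : ℕ}
    (hV : ∀ l : List (Fin k), l.length ≤ d → (l.map Y).prod (V ξ) ∈ Set.range V)
    {p : FreeAlgebra ℂ (Fin k)} (hp : p ∈ degreeLE k d) :
    V (FreeAlgebra.lift ℂ (compress V Y) p ξ) = FreeAlgebra.lift ℂ Y p (V ξ) := by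
  induction hp using Submodule.span_induction with
  | mem x hx =>
    obtain ⟨l, hl, rfl⟩ := hx
    simpa [map_list_prod, Function.comp_def] using map_word_compress V Y ξ hV l hl
  | zero => simp
  | add x y _ _ hx hy => simp [hx, hy]
  | smul c x _ hx => simp [hx]

theorem exists_isometry_of_finite {S : Set E} (hS : S.Finite) :
    ∃ (ℓ : ℕ) (V : EuclideanSpace ℂ (Fin ℓ) →ₗᵢ[ℂ] E), S ⊆ Set.range V := by
  have : FiniteDimensional ℂ (Submodule.span ℂ S) := FiniteDimensional.span_of_finite ℂ hS
  let b := stdOrthonormalBasis ℂ (Submodule.span ℂ S)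
  exact ⟨_, (Submodule.span ℂ S).subtypeₗᵢ.comp b.repr.symm.toLinearIsometry, fun v hv =>
    ⟨b.repr ⟨v, Submodule.subset_span hv⟩, by simp⟩⟩

theorem exists_finite_compression {Y : Fin k → (E →L[ℂ] E)} (hY : IsPovmTuple Y) (d : ℕ)
    {e : E} (he : ‖e‖ = 1) :
    ∃ (ℓ : ℕ) (Z : Fin k → (EuclideanSpace ℂ (Fin ℓ) →L[ℂ] EuclideanSpace ℂ (Fin ℓ)))
      (ξ : EuclideanSpace ℂ (Fin ℓ)), IsPovmTuple Z ∧ ‖ξ‖ = 1 ∧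
        ∀ p ∈ degreeLE k d, ‖FreeAlgebra.lift ℂ Y p e‖ = ‖FreeAlgebra.lift ℂ Z p ξ‖ := by
  obtain ⟨ℓ, V, hV⟩ := exists_isometry_of_finite
    ((List.finite_length_le (Fin k) d).image fun l => (l.map Y).prod e)
  have hw : ∀ l : List (Fin k), l.length ≤ d → (l.map Y).prod e ∈ Set.range V :=
    fun l hl => hV ⟨l, hl, rfl⟩
  obtain ⟨ξ, rfl⟩ : e ∈ Set.range V := hw [] (Nat.zero_le d)
  refine ⟨_, compress V Y, ξ, hY.compress V, by rwa [V.norm_map] at he, fun p hp => ?_⟩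
  rw [← map_lift_compress V Y ξ hw hp, V.norm_map]

theorem norm_lift_le_of_povmNormLE {Y : Fin k → (E →L[ℂ] E)} (hY : IsPovmTuple Y)
    {p : FreeAlgebra ℂ (Fin k)} {c : ℝ} (hc : povmNormLE k p c) :
    ‖FreeAlgebra.lift ℂ Y p‖ ≤ c := by
  have hc0 : 0 ≤ c := (norm_nonneg _).trans <| hc 0 0
    ⟨fun j => ContinuousLinearMap.isPositive_zero, by simp⟩
  obtain ⟨d, hd⟩ := exists_mem_degreeLE p
  refine ContinuousLinearMap.opNorm_le_of_unit_norm (𝕜 := ℂ) hc0 fun e he => ?_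
  obtain ⟨ℓ, Z, ξ, hZ, hξ, h⟩ := exists_finite_compression hY d he
  rw [h p hd]
  simpa [hξ] using (FreeAlgebra.lift ℂ Z p).le_of_opNorm_le (hc ℓ Z hZ) ξ

end Compression

/-- Finite-dimensional compression: if `Y ∈ D_n(E)` then for each degree `d` and unit
vector `e ∈ E` there are a matrix level `E' ∈ D_n(ℂ^ℓ)` and a unit vector `ξ` with
`‖p(Y)e‖ = ‖p(E')ξ‖` for all `p` of degree at most `d`; in particular
`‖p(Y)‖ ≤ ‖p‖_{povm(n)}` for all `p`. -/
theorem povm_tuple_compression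
    (n : ℕ) (hn : 2 ≤ n)
    (E : Type) [NormedAddCommGroup E] [InnerProductSpace ℂ E] [CompleteSpace E]
    (Y : Fin (n - 1) → (E →L[ℂ] E)) (hY : IsPovmTuple Y) :
    (∀ (d : ℕ) (e : E), ‖e‖ = 1 →
      ∃ (ℓ : ℕ)
        (Eop : Fin (n - 1) → (EuclideanSpace ℂ (Fin ℓ) →L[ℂ] EuclideanSpace ℂ (Fin ℓ)))
        (ξ : EuclideanSpace ℂ (Fin ℓ)),
        IsPovmTuple Eop ∧ ‖ξ‖ = 1 ∧
        ∀ p ∈ Submodule.span ℂ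
            {x : FreeAlgebra ℂ (Fin (n - 1)) |
              ∃ l : List (Fin (n - 1)), l.length ≤ d ∧
                x = (l.map (FreeAlgebra.ι ℂ)).prod},
          ‖(FreeAlgebra.lift ℂ Y p) e‖ = ‖(FreeAlgebra.lift ℂ Eop p) ξ‖) ∧
    (∀ (p : FreeAlgebra ℂ (Fin (n - 1))) (c : ℝ),
      povmNormLE (n - 1) p c → ‖FreeAlgebra.lift ℂ Y p‖ ≤ c) := by
  exact ⟨fun d _ he => exists_finite_compression hY d he,
    fun _ _ hc => norm_lift_le_of_povmNormLE hY hc⟩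

end POVMStmt
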